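/- Let f : ℕ → ℕ have controlled growth, fix d ≥ 1, and let O = (v_n, n ≥ 1) and P = (u_n, n ≥ 1) be activator sequences on G(f) such that for every n ≥ 1, v_n and u_n are either both ∅, or both vertices with dist_{G_n}(v_n, u_n) ≤ d. Then δ̲(G(f),P) = δ̲(G(f),O) and δ̄(G(f),P) = δ̄(G(f),O). -/

import Mathlib

open Filter Asymptotics

/-- Membership in the grid `[-f n, f n]^2 ⊆ ℤ × ℤ`. -/
def inGrid (f : ℕ → ℕ) (n : ℕ) (p : ℤ × ℤ) : Prop :=
  |p.1| ≤ (f n : ℤ) ∧ |p.2| ≤ (f n : ℤ)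

instance (f : ℕ → ℕ) (n : ℕ) : DecidablePred (inGrid f n) := fun _ => by
  unfold inGrid; infer_instance

/-- The four lattice neighbours (at `L¹`-distance one) of a point. -/
def nbrs (p : ℤ × ℤ) : Finset (ℤ × ℤ) :=
  {(p.1 + 1, p.2), (p.1 - 1, p.2), (p.1, p.2 + 1), (p.1, p.2 - 1)}

/-- An activator sequence: whenever `V n ≠ ∅` (for `n ≥ 1`), the activated vertex
lies in the grid at time `n`. -/
def IsActivator (f : ℕ → ℕ) (V : ℕ → Option (ℤ × ℤ)) : Prop :=
  ∀ n, 1 ≤ n → ∀ p, V n = some p → inGrid f n p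

/-- The burning process: `B 0 = ∅`, and `B n` is obtained from `B (n-1)` by adding all
vertices of the grid at time `n` adjacent to a vertex of `B (n-1)`, and then adding
the activator `V n` if it is not `∅`. -/
def burnSet (f : ℕ → ℕ) (V : ℕ → Option (ℤ × ℤ)) : ℕ → Finset (ℤ × ℤ)
  | 0 => ∅
  | n + 1 =>
    let B := burnSet f V n
    let spread := B ∪ (B.biUnion nbrs).filter (inGrid f (n + 1))
    match V (n + 1) with
    | none => spread
    | some v => insert v spread

/-- The proportion `|B n| / |V(G n)|` of burning vertices at time `n`. -/
noncomputable def densitySeq (f : ℕ → ℕ) (V : ℕ → Option (ℤ × ℤ)) (n : ℕ) : ℝ :=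
  ((burnSet f V n).card : ℝ) / (2 * (f n : ℝ) + 1) ^ 2

/-- The lower burning density `δ̲(G(f), V)`. -/
noncomputable def lowerDensity (f : ℕ → ℕ) (V : ℕ → Option (ℤ × ℤ)) : ℝ :=
  liminf (densitySeq f V) atTop

/-- The upper burning density `δ̄(G(f), V)`. -/
noncomputable def upperDensity (f : ℕ → ℕ) (V : ℕ → Option (ℤ × ℤ)) : ℝ :=
  limsup (densitySeq f V) atTop

/-- The burning density of `V` in `G(f)` exists and equals `ρ`. -/
def HasBurningDensity (f : ℕ → ℕ) (V : ℕ → Option (ℤ × ℤ)) (ρ : ℝ) : Prop :=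
  Tendsto (densitySeq f V) atTop (nhds ρ)

/-- `P(G(f))`: the set of `ρ ∈ [0,1]` achievable as the burning density of some
non-empty activator sequence. -/
def densSet (f : ℕ → ℕ) : Set ℝ :=
  {ρ | ρ ∈ Set.Icc (0 : ℝ) 1 ∧
    ∃ V : ℕ → Option (ℤ × ℤ), IsActivator f V ∧ (∃ t, 1 ≤ t ∧ V t ≠ none) ∧
      HasBurningDensity f V ρ}

/-- The controlled growth requirement. -/
def ControlledGrowth (f : ℕ → ℕ) : Prop :=
  (∀ᶠ n in atTop, f n < f (n + 1)) ∧
  (∀ ε : ℕ → ℕ, (fun n => (ε n : ℝ)) =o[atTop] (fun n => (n : ℝ)) →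
    Tendsto (fun n => (f (n + ε n) : ℝ) / (f n : ℝ)) atTop (nhds 1)) ∧
  (∀ c : ℝ, 0 < c → ∃ d : ℝ, 0 < d ∧
    ∀ᶠ n in atTop, (1 + d) * (f n : ℝ) ≤ (f (n + ⌈c * n⌉₊) : ℝ))

/-- The `L¹`-distance on `ℤ × ℤ`. -/
def taxi (p q : ℤ × ℤ) : ℕ := (p.1 - q.1).natAbs + (p.2 - q.2).natAbs

/-- The square `[-L, L]^2` translated by `p`. -/
noncomputable def box (p : ℤ × ℤ) (L : ℕ) : Finset (ℤ × ℤ) :=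
  Finset.Icc (p.1 - L) (p.1 + L) ×ˢ Finset.Icc (p.2 - L) (p.2 + L)

theorem add_nsmul_fst (x v : ℤ × ℤ) (j : ℕ) : (x + j • v).1 = x.1 + j * v.1 := by
  rw [Prod.fst_add, Prod.smul_fst, nsmul_eq_mul]

theorem add_nsmul_snd (x v : ℤ × ℤ) (j : ℕ) : (x + j • v).2 = x.2 + j * v.2 := by
  rw [Prod.snd_add, Prod.smul_snd, nsmul_eq_mul]

theorem card_box (p : ℤ × ℤ) (L : ℕ) : (box p L).card = (2 * L + 1) ^ 2 := by
  have h (a : ℤ) : (a + L + 1 - (a - L)).toNat = 2 * L + 1 := by omega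
  simp [box, h, sq]

theorem mem_nbrs_iff {p q : ℤ × ℤ} : q ∈ nbrs p ↔ taxi q p = 1 := by
  obtain ⟨a, b⟩ := p
  obtain ⟨c, e⟩ := q
  simp only [nbrs, taxi, Finset.mem_insert, Finset.mem_singleton, Prod.mk.injEq]
  omega

theorem inGrid_iff {f : ℕ → ℕ} {n : ℕ} {p : ℤ × ℤ} :
    inGrid f n p ↔ p.1.natAbs ≤ f n ∧ p.2.natAbs ≤ f n := by
  simp only [inGrid, Int.abs_eq_natAbs, Nat.cast_le]

theorem mem_burnSet_succ {f : ℕ → ℕ} {V : ℕ → Option (ℤ × ℤ)} {n : ℕ} {q : ℤ × ℤ} :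
    q ∈ burnSet f V (n + 1) ↔ q ∈ burnSet f V n ∨
      ((∃ p ∈ burnSet f V n, taxi q p = 1) ∧ inGrid f (n + 1) q) ∨ V (n + 1) = some q := by
  rw [burnSet]
  cases h : V (n + 1) with
  | none => simp [mem_nbrs_iff]
  | some v =>
    simp only [Finset.mem_insert, Finset.mem_union, Finset.mem_filter, Finset.mem_biUnion,
      mem_nbrs_iff, Option.some.injEq, eq_comm (a := q)]
    rw [or_comm, or_assoc]

theorem burnSet_mono (f : ℕ → ℕ) (V : ℕ → Option (ℤ × ℤ)) : Monotone (burnSet f V) :=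
  monotone_nat_of_le_succ fun _ _ hq => mem_burnSet_succ.2 (Or.inl hq)

theorem mem_burnSet_of_eq_some {f : ℕ → ℕ} {V : ℕ → Option (ℤ × ℤ)} {i : ℕ} {p : ℤ × ℤ}
    (hi : 1 ≤ i) (h : V i = some p) : p ∈ burnSet f V i := by
  obtain ⟨k, rfl⟩ : ∃ k, i = k + 1 := ⟨i - 1, by omega⟩
  exact mem_burnSet_succ.2 (Or.inr (Or.inr h))

theorem exists_source_of_mem_burnSet {f : ℕ → ℕ} {V : ℕ → Option (ℤ × ℤ)} {n : ℕ} {q : ℤ × ℤ}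
    (hq : q ∈ burnSet f V n) : ∃ i p, 1 ≤ i ∧ V i = some p ∧ taxi q p + i ≤ n := by
  induction n generalizing q with
  | zero => simp [burnSet] at hq
  | succ n ih =>
    rcases mem_burnSet_succ.1 hq with h | ⟨⟨p, hp, hqp⟩, -⟩ | h
    · obtain ⟨i, p, hi, hV, hd⟩ := ih h
      exact ⟨i, p, hi, hV, by omega⟩
    · obtain ⟨i, p', hi, hV, hd⟩ := ih hp
      refine ⟨i, p', hi, hV, ?_⟩
      unfold taxi at *
      omega
    · exact ⟨n + 1, q, by omega, h, by simp [taxi]⟩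

theorem exists_taxi_eq_one {p q : ℤ × ℤ} {k : ℕ} (h : taxi q p = k + 1) :
    ∃ r, taxi q r = 1 ∧ taxi r p = k := by
  obtain ⟨a, b⟩ := p
  obtain ⟨c, e⟩ := q
  simp only [taxi] at *
  rcases lt_trichotomy a c with h1 | h1 | h1
  · exact ⟨(c - 1, e), by omega, by omega⟩
  · rcases lt_trichotomy b e with h2 | h2 | h2
    · exact ⟨(c, e - 1), by omega, by omega⟩
    · omega
    · exact ⟨(c, e + 1), by omega, by omega⟩
  · exact ⟨(c + 1, e), by omega, by omega⟩

/-- Once the grid grows strictly, fire spreads along geodesics without being obstructed. -/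
theorem mem_burnSet_of_taxi_le {f : ℕ → ℕ} {V : ℕ → Option (ℤ × ℤ)} {N a : ℕ} {p : ℤ × ℤ}
    (hf : ∀ k ≥ N, f k < f (k + 1)) (ha : N ≤ a) (hp : p ∈ burnSet f V a) (hpg : inGrid f a p)
    (k : ℕ) (q : ℤ × ℤ) (hq : taxi q p ≤ k) :
    q ∈ burnSet f V (a + k) ∧ inGrid f (a + k) q := by
  induction k generalizing q with
  | zero =>
    have : q = p := by
      unfold taxi at hq
      ext <;> omega
    subst this
    exact ⟨hp, hpg⟩
  | succ k ih =>
    have hlt := hf (a + k) (by omega)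
    rcases Nat.lt_or_ge (taxi q p) (k + 1) with h | h
    · obtain ⟨h1, h2⟩ := ih q (by omega)
      rw [inGrid_iff] at h2 ⊢
      exact ⟨burnSet_mono f V (by omega) h1, by rw [← add_assoc]; omega⟩
    · obtain ⟨r, hqr, hr⟩ := exists_taxi_eq_one (le_antisymm hq h)
      obtain ⟨h1, h2⟩ := ih r hr.le
      have hg : inGrid f (a + k + 1) q := by
        rw [inGrid_iff] at h2 ⊢
        unfold taxi at hqr
        omega
      exact ⟨mem_burnSet_succ.2 (Or.inr (Or.inl ⟨⟨r, h1, hqr⟩, hg⟩)), hg⟩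

/-- A set whose first `m` translates by multiples of `v` lie in a set disjoint from it is
small: the translates are pairwise disjoint. -/
theorem mul_card_le_of_translates {E S T : Finset (ℤ × ℤ)} {v : ℤ × ℤ} {m : ℕ}
    (hES : ∀ x ∈ E, x ∉ S) (hS : ∀ x ∈ E, ∀ j : ℕ, 1 ≤ j → j ≤ m → x + j • v ∈ S)
    (hT : ∀ x ∈ E, ∀ j : ℕ, j ≤ m → x + j • v ∈ T) : m * E.card ≤ T.card := by
  have key : ∀ j j' : ℕ, ∀ x ∈ E, ∀ x' ∈ E, j < j' → j' < m → x + j • v ≠ x' + j' • v := by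
    intro j j' x hx x' hx' hlt hm heq
    apply hES x hx
    obtain ⟨c, rfl⟩ := Nat.exists_eq_add_of_lt hlt
    have : x = x' + (c + 1) • v := by
      have : x + j • v = x' + (c + 1) • v + j • v := by rw [heq, add_assoc j, add_smul j]; abel
      exact add_right_cancel this
    rw [this]
    exact hS x' hx' _ (by omega) (by omega)
  have := Finset.card_le_card_of_injOn (s := Finset.range m ×ˢ E) (t := T)
    (fun z => z.2 + z.1 • v) ?_ ?_
  · simpa using this
  · rintro ⟨j, x⟩ hz
    simp only [Finset.coe_product, Set.mem_prod, Finset.mem_coe, Finset.mem_range] at hz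
    exact hT x hz.2 j hz.1.le
  · rintro ⟨j, x⟩ hz ⟨j', x'⟩ hz' heq
    simp only [Finset.coe_product, Set.mem_prod, Finset.mem_coe, Finset.mem_range] at hz hz' heq
    rcases lt_trichotomy j j' with h | h | h
    · exact absurd heq (key j j' x hz.2 x' hz'.2 h hz'.1)
    · subst h
      rw [add_right_cancel heq]
    · exact absurd heq.symm (key j' j x' hz'.2 x hz.2 h hz.1)

theorem exists_growth_bounds {f : ℕ → ℕ} (h : ∀ᶠ n in atTop, f n < f (n + 1)) :
    ∃ N, (∀ k ≥ N, f k < f (k + 1)) ∧ (∀ n ≥ N, ∀ i ≤ n, f i ≤ f n) ∧ ∀ n, n ≤ f n + N := by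
  obtain ⟨M, hM⟩ := eventually_atTop.1 h
  have hlin : ∀ n k, M ≤ n → f n + k ≤ f (n + k) := by
    intro n k hn
    induction k with
    | zero => rfl
    | succ k ih =>
      have := hM (n + k) (by omega)
      rw [← add_assoc n]
      omega
  refine ⟨M + ∑ i ∈ Finset.range M, f i, fun k hk => hM k (by omega), ?_, ?_⟩
  · intro n hn i hi
    rcases Nat.lt_or_ge i M with h' | h'
    · have h1 := Finset.single_le_sum (f := f) (fun _ _ => Nat.zero_le _) (Finset.mem_range.2 h')
      have h2 := hlin M (n - M) le_rfl
      rw [show M + (n - M) = n by omega] at h2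
      omega
    · have h2 := hlin i (n - i) h'
      rw [show i + (n - i) = n by omega] at h2
      omega
  · intro n
    rcases Nat.lt_or_ge n M with h' | h'
    · omega
    · have h2 := hlin M (n - M) le_rfl
      rw [show M + (n - M) = n by omega] at h2
      omega

theorem burnSet_subset_box {f : ℕ → ℕ} {V : ℕ → Option (ℤ × ℤ)} {N n : ℕ} (hV : IsActivator f V)
    (hmono : ∀ n ≥ N, ∀ i ≤ n, f i ≤ f n) (hlin : ∀ n, n ≤ f n + N) (hn : N ≤ n) :
    burnSet f V n ⊆ box 0 (2 * f n + N) := by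
  intro x hx
  obtain ⟨i, p, hi, hp, hd⟩ := exists_source_of_mem_burnSet hx
  have h1 := inGrid_iff.1 (hV i hi p hp)
  have h2 := hmono n hn i (by omega)
  have h3 := hlin n
  unfold taxi at hd
  simp only [box, Finset.mem_product, Finset.mem_Icc, Prod.fst_zero, Prod.snd_zero]
  push_cast
  omega

/-- Vertices burning for `O` but not for `P` are near a recently activated vertex or belong to
one of four sets having many translates that burn for `P`. -/
theorem mul_card_burnSet_sdiff_le {f : ℕ → ℕ} {d N m n R : ℕ} {O P : ℕ → Option (ℤ × ℤ)}
    (hO : IsActivator f O) (hP : IsActivator f P)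
    (hclose : ∀ n, 1 ≤ n → ∀ p, O n = some p → ∃ q, P n = some q ∧ taxi p q ≤ d)
    (hf : ∀ k ≥ N, f k < f (k + 1)) (hmono : ∀ n ≥ N, ∀ i ≤ n, f i ≤ f n)
    (hlin : ∀ n, n ≤ f n + N) (hn : N ≤ n) (hfn : N + m * (d + N) ≤ f n)
    (hR : R = 2 * (m * (d + N)) + N) :
    m * (burnSet f O n \ burnSet f P n).card ≤
      m * (R * (2 * R + 1) ^ 2) + 4 * (2 * (4 * f n) + 1) ^ 2 := by
  set D := d + N with hD
  set S := burnSet f P n with hS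
  set E := burnSet f O n \ S with hE
  let F : ℤ × ℤ → Finset (ℤ × ℤ) := fun v =>
    E.filter fun x => ∀ j ∈ Finset.Icc 1 m, x + j • v ∈ S
  let A : Finset (ℤ × ℤ) :=
    (Finset.range R).biUnion fun k => (O (n - k)).elim ∅ fun p => box p R
  have hA : A.card ≤ R * (2 * R + 1) ^ 2 := by
    have := Finset.card_biUnion_le_card_mul (Finset.range R)
      (fun k => (O (n - k)).elim ∅ fun p => box p R) ((2 * R + 1) ^ 2) (by
        intro k _
        cases O (n - k) with
        | none => simp
        | some p => simp [card_box])
    simpa using this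
  have hF : ∀ v : ℤ × ℤ, v.1.natAbs ≤ D → v.2.natAbs ≤ D →
      m * (F v).card ≤ (2 * (4 * f n) + 1) ^ 2 := by
    intro v hv1 hv2
    rw [← card_box 0]
    refine mul_card_le_of_translates (S := S) (v := v) ?_ ?_ ?_
    · intro x hx
      exact (Finset.mem_sdiff.1 (Finset.mem_filter.1 hx).1).2
    · intro x hx j h1 h2
      exact (Finset.mem_filter.1 hx).2 j (Finset.mem_Icc.2 ⟨h1, h2⟩)
    · intro x hx j hj
      have hb := burnSet_subset_box hO hmono hlin hn
        (Finset.mem_sdiff.1 (Finset.mem_filter.1 hx).1).1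
      have h1 : ((j : ℤ) * v.1).natAbs ≤ m * D := by
        rw [Int.natAbs_mul, Int.natAbs_natCast]; exact Nat.mul_le_mul hj hv1
      have h2 : ((j : ℤ) * v.2).natAbs ≤ m * D := by
        rw [Int.natAbs_mul, Int.natAbs_natCast]; exact Nat.mul_le_mul hj hv2
      simp only [box, Finset.mem_product, Finset.mem_Icc, Prod.fst_zero, Prod.snd_zero,
        add_nsmul_fst, add_nsmul_snd] at hb ⊢
      push_cast at hb ⊢
      omega
  have hcover : E ⊆ A ∪ (F (D, 0) ∪ (F (-D, 0) ∪ (F (0, D) ∪ F (0, -D)))) := by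
    intro x hx
    obtain ⟨hxO, hxS⟩ := Finset.mem_sdiff.1 hx
    obtain ⟨i, p, hi, hp, hd⟩ := exists_source_of_mem_burnSet hxO
    obtain ⟨q, hq, hpq⟩ := hclose i hi p hp
    have hmem : ∀ y, taxi y q + (N + i) ≤ n → y ∈ S := by
      intro y hy
      have hg : inGrid f (N + i) q := by
        have h1 := inGrid_iff.1 (hP i hi q hq)
        have h2 := hmono (N + i) (by omega) i (by omega)
        rw [inGrid_iff]
        omega
      have h := (mem_burnSet_of_taxi_le hf (by omega)
        (burnSet_mono f P (by omega) (mem_burnSet_of_eq_some hi hq)) hg (n - (N + i)) y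
        (by omega)).1
      rwa [show N + i + (n - (N + i)) = n by omega] at h
    have hxq : n < taxi x q + (N + i) := by
      by_contra! h
      exact hxS (hmem x h)
    rcases Nat.lt_or_ge (n - i) R with hlt | hge
    · refine Finset.mem_union_left _ (Finset.mem_biUnion.2
        ⟨n - i, Finset.mem_range.2 hlt, ?_⟩)
      rw [show n - (n - i) = i by omega, hp]
      simp only [Option.elim, box, Finset.mem_product, Finset.mem_Icc]
      unfold taxi at hd
      omega
    · refine Finset.mem_union_right _ ?_
      have hstep : ∀ j ∈ Finset.Icc 1 m, D ≤ j * D ∧ j * D ≤ m * D := by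
        intro j hj
        rw [Finset.mem_Icc] at hj
        exact ⟨Nat.le_mul_of_pos_left _ hj.1, Nat.mul_le_mul_right _ hj.2⟩
      simp only [Finset.mem_union, F, Finset.mem_filter, hx, true_and]
      unfold taxi at *
      have hcases : (m * D : ℕ) ≤ q.1 - x.1 ∨ (m * D : ℕ) ≤ x.1 - q.1 ∨
          (m * D : ℕ) ≤ q.2 - x.2 ∨ (m * D : ℕ) ≤ x.2 - q.2 := by
        omega
      rcases hcases with h | h | h | h
      · refine Or.inl fun j hj => hmem _ ?_
        obtain ⟨h1, h2⟩ := hstep j hj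
        simp only [add_nsmul_fst, add_nsmul_snd, mul_zero, ← Nat.cast_mul]
        omega
      · refine Or.inr (Or.inl fun j hj => hmem _ ?_)
        obtain ⟨h1, h2⟩ := hstep j hj
        simp only [add_nsmul_fst, add_nsmul_snd, mul_zero, mul_neg, ← Nat.cast_mul]
        omega
      · refine Or.inr (Or.inr (Or.inl fun j hj => hmem _ ?_))
        obtain ⟨h1, h2⟩ := hstep j hj
        simp only [add_nsmul_fst, add_nsmul_snd, mul_zero, ← Nat.cast_mul]
        omega
      · refine Or.inr (Or.inr (Or.inr fun j hj => hmem _ ?_))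
        obtain ⟨h1, h2⟩ := hstep j hj
        simp only [add_nsmul_fst, add_nsmul_snd, mul_zero, mul_neg, ← Nat.cast_mul]
        omega
  have hcard : E.card ≤ A.card + ((F (D, 0)).card + ((F (-D, 0)).card +
      ((F (0, D)).card + (F (0, -D)).card))) := by
    refine (Finset.card_le_card hcover).trans ((Finset.card_union_le _ _).trans ?_)
    gcongr
    refine (Finset.card_union_le _ _).trans ?_
    gcongr
    refine (Finset.card_union_le _ _).trans ?_
    gcongr
    exact Finset.card_union_le _ _
  have h1 := hF (D, 0) (by simp) (by simp)
  have h2 := hF (-D, 0) (by simp) (by simp)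
  have h3 := hF (0, D) (by simp) (by simp)
  have h4 := hF (0, -D) (by simp) (by simp)
  have h5 := Nat.mul_le_mul_left m hcard
  have h6 := Nat.mul_le_mul_left m hA
  simp only [mul_add m] at h5
  omega

theorem eventually_densitySeq_le_add {f : ℕ → ℕ} {d : ℕ} {O P : ℕ → Option (ℤ × ℤ)}
    (hf : ∀ᶠ n in atTop, f n < f (n + 1)) (hO : IsActivator f O) (hP : IsActivator f P)
    (hclose : ∀ n, 1 ≤ n → ∀ p, O n = some p → ∃ q, P n = some q ∧ taxi p q ≤ d)
    {ε : ℝ} (hε : 0 < ε) :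
    ∀ᶠ n in atTop, densitySeq f O n ≤ densitySeq f P n + ε := by
  obtain ⟨N, hinc, hmono, hlin⟩ := exists_growth_bounds hf
  obtain ⟨m, hm⟩ := exists_nat_gt (128 / ε)
  have hm0 : (0 : ℝ) < m := lt_trans (by positivity) hm
  obtain ⟨K, hK⟩ : ∃ K : ℕ, ∀ n ≥ 2 * N + m * (d + N),
      m * (burnSet f O n \ burnSet f P n).card ≤ m * K + 4 * (2 * (4 * f n) + 1) ^ 2 := by
    refine ⟨(2 * (m * (d + N)) + N) * (2 * (2 * (m * (d + N)) + N) + 1) ^ 2, fun n hn => ?_⟩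
    exact mul_card_burnSet_sdiff_le hO hP hclose hinc hmono hlin (by omega)
      (by have := hlin n; omega) rfl
  obtain ⟨L, hL⟩ := exists_nat_gt (2 * K / ε)
  filter_upwards [eventually_ge_atTop (2 * N + m * (d + N) + L)] with n hn
  have h1 : (m : ℝ) * ((burnSet f O n \ burnSet f P n).card : ℝ) ≤
      m * K + 4 * (2 * (4 * (f n : ℝ)) + 1) ^ 2 := by
    exact_mod_cast hK n (by omega)
  have h2 : ((burnSet f O n).card : ℝ) ≤
      (burnSet f P n).card + (burnSet f O n \ burnSet f P n).card := by
    have := Finset.card_le_card_sdiff_add_card (s := burnSet f O n) (t := burnSet f P n)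
    rw [add_comm]
    exact_mod_cast this
  have hfL : (L : ℝ) ≤ f n := by
    have := hlin n
    exact_mod_cast (show L ≤ f n by omega)
  set a : ℝ := (f n : ℝ)
  have ha : 0 ≤ a := (Nat.cast_nonneg L).trans hfL
  set g : ℝ := (2 * a + 1) ^ 2 with hg
  have hg0 : 0 < g := by positivity
  have h3 : (2 * (4 * a) + 1) ^ 2 ≤ 16 * g := by rw [hg]; nlinarith
  have h4 : 2 * K ≤ ε * g := by
    have h5 : 2 * (K : ℝ) < L * ε := (div_lt_iff₀ hε).1 hL
    have h6 : (L : ℝ) ≤ g := by rw [hg]; nlinarith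
    nlinarith
  have h7 : 128 < m * ε := (div_lt_iff₀ hε).1 hm
  have h8 : ((burnSet f O n \ burnSet f P n).card : ℝ) ≤ ε * g := by
    refine le_of_mul_le_mul_left ?_ hm0
    nlinarith
  unfold densitySeq
  rw [div_add' _ _ _ hg0.ne']
  gcongr
  linarith

theorem exists_eventually_densitySeq_le {f : ℕ → ℕ} {V : ℕ → Option (ℤ × ℤ)}
    (hf : ∀ᶠ n in atTop, f n < f (n + 1)) (hV : IsActivator f V) :
    ∃ C : ℝ, ∀ᶠ n in atTop, densitySeq f V n ≤ C := by
  obtain ⟨N, -, hmono, hlin⟩ := exists_growth_bounds hf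
  refine ⟨9, ?_⟩
  filter_upwards [eventually_ge_atTop (2 * N)] with n hn
  have h1 := Finset.card_le_card (burnSet_subset_box hV hmono hlin (show N ≤ n by omega))
  have h2 : N ≤ f n := by have := hlin n; omega
  rw [card_box] at h1
  have h3 : (burnSet f V n).card ≤ 9 * (2 * f n + 1) ^ 2 := by nlinarith
  unfold densitySeq
  rw [div_le_iff₀ (by positivity)]
  exact_mod_cast h3

theorem limsup_le_and_liminf_le_of_eventually_le_add {a b : ℕ → ℝ}
    (ha0 : ∀ n, 0 ≤ a n) (hb0 : ∀ n, 0 ≤ b n) (ha : ∃ C, ∀ᶠ n in atTop, a n ≤ C)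
    (hb : ∃ C, ∀ᶠ n in atTop, b n ≤ C)
    (h : ∀ ε > 0, ∀ᶠ n in atTop, a n ≤ b n + ε) :
    liminf a atTop ≤ liminf b atTop ∧ limsup a atTop ≤ limsup b atTop := by
  have bda : IsBoundedUnder (· ≤ ·) atTop a := ha
  have bdb : IsBoundedUnder (· ≤ ·) atTop b := hb
  have bda' : IsBoundedUnder (· ≥ ·) atTop a := ⟨0, by simpa using ⟨0, fun n _ => ha0 n⟩⟩
  have bdb' : IsBoundedUnder (· ≥ ·) atTop b := ⟨0, by simpa using ⟨0, fun n _ => hb0 n⟩⟩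
  constructor
  · refine le_of_forall_pos_le_add fun ε hε => ?_
    rw [← liminf_add_const atTop b ε bdb.isCoboundedUnder_ge bdb']
    refine liminf_le_liminf (h ε hε) bda' (IsBoundedUnder.isCoboundedUnder_ge ?_)
    exact isBoundedUnder_le_add bdb isBoundedUnder_const
  · refine le_of_forall_pos_le_add fun ε hε => ?_
    rw [← limsup_add_const atTop b ε bdb bdb'.isCoboundedUnder_le]
    refine limsup_le_limsup (h ε hε) bda'.isCoboundedUnder_le ?_
    exact isBoundedUnder_le_add bdb isBoundedUnder_const

/-- perturbing each activator by (graph = `L¹`) distance at most `d`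
does not change the lower and upper burning densities. -/
theorem perturbed_sequence_same_density (f : ℕ → ℕ) (hcg : ControlledGrowth f)
    (d : ℕ) (hd : 1 ≤ d) (O P : ℕ → Option (ℤ × ℤ))
    (hO : IsActivator f O) (hP : IsActivator f P)
    (hclose : ∀ n, 1 ≤ n → (O n = none ∧ P n = none) ∨
      ∃ p q : ℤ × ℤ, O n = some p ∧ P n = some q ∧
        |p.1 - q.1| + |p.2 - q.2| ≤ (d : ℤ)) :
    lowerDensity f P = lowerDensity f O ∧ upperDensity f P = upperDensity f O := by
  have nonneg (V : ℕ → Option (ℤ × ℤ)) (n : ℕ) : 0 ≤ densitySeq f V n := by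
    unfold densitySeq
    positivity
  have hOP : ∀ n, 1 ≤ n → ∀ p, O n = some p → ∃ q, P n = some q ∧ taxi p q ≤ d := by
    intro n hn p hp
    rcases hclose n hn with ⟨h, -⟩ | ⟨p', q, h1, h2, h3⟩
    · simp [h] at hp
    · obtain rfl : p' = p := by simpa [h1] using hp
      refine ⟨q, h2, ?_⟩
      simp only [Int.abs_eq_natAbs] at h3
      unfold taxi
      omega
  have hPO : ∀ n, 1 ≤ n → ∀ p, P n = some p → ∃ q, O n = some q ∧ taxi p q ≤ d := by
    intro n hn p hp
    rcases hclose n hn with ⟨-, h⟩ | ⟨q, p', h1, h2, h3⟩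
    · simp [h] at hp
    · obtain rfl : p' = p := by simpa [h2] using hp
      refine ⟨q, h1, ?_⟩
      simp only [Int.abs_eq_natAbs] at h3
      unfold taxi
      omega
  have bO := exists_eventually_densitySeq_le hcg.1 hO
  have bP := exists_eventually_densitySeq_le hcg.1 hP
  have h1 := limsup_le_and_liminf_le_of_eventually_le_add (nonneg O) (nonneg P) bO bP
    fun _ hε => eventually_densitySeq_le_add hcg.1 hO hP hOP hε
  have h2 := limsup_le_and_liminf_le_of_eventually_le_add (nonneg P) (nonneg O) bP bO
    fun _ hε => eventually_densitySeq_le_add hcg.1 hP hO hPO hε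
  exact ⟨le_antisymm h2.1 h1.1, le_antisymm h2.2 h1.2⟩
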